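/- Let X be a real random variable with distribution N(μ,σ²), σ ≥ 0, and let α₁, α₂, β₁, β₂ ∈ ℝ. Then E[exp(α₁X + β₁)·Φ(α₂X + β₂)] = exp(α₁μ + β₁ + α₁²σ²/2)·Φ((α₂μ + β₂ + α₁α₂σ²)/√(1 + α₂²σ²)). -/

import Mathlib

open MeasureTheory ProbabilityTheory

/-- The standard normal density `φ(x) = (2π)^{−1/2} e^{−x²/2}`. -/
noncomputable def stdNormalPdf (x : ℝ) : ℝ :=
  (Real.sqrt (2 * Real.pi))⁻¹ * Real.exp (-x ^ 2 / 2)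

/-- The standard normal cumulative distribution function `Φ(x) = ∫_{−∞}^x φ(u) du`. -/
noncomputable def stdNormalCdf (x : ℝ) : ℝ :=
  ∫ u in Set.Iic x, stdNormalPdf u


lemma stdNormalCdf_eq_gaussianReal_Iic (x : ℝ) :
    stdNormalCdf x = (gaussianReal 0 1).real (Set.Iic x) := by
  have h : stdNormalPdf = gaussianPDFReal 0 1 := by
    ext u
    simp [stdNormalPdf, gaussianPDFReal]
  rw [measureReal_def, gaussianReal_apply_eq_integral _ one_ne_zero, ENNReal.toReal_ofReal
    (integral_nonneg fun _ ↦ gaussianPDFReal_nonneg _ _ _), stdNormalCdf, h]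

lemma monotone_stdNormalCdf : Monotone stdNormalCdf := by
  intro x y hxy
  simp_rw [stdNormalCdf_eq_gaussianReal_Iic]
  exact measureReal_mono (Set.Iic_subset_Iic.mpr hxy)

lemma gaussianReal_real_Iic (m c : ℝ) {w : NNReal} (hw : w ≠ 0) :
    (gaussianReal m w).real (Set.Iic c) = stdNormalCdf ((c - m) / √w) := by
  have hw' : 0 < √(w : ℝ) := Real.sqrt_pos.mpr (by positivity)
  have h : gaussianReal m w = (gaussianReal 0 1).map (fun x ↦ √w * x + m) := by
    change _ = (gaussianReal 0 1).map ((· + m) ∘ (√(w : ℝ) * ·))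
    rw [← Measure.map_map (by fun_prop) (by fun_prop),
      gaussianReal_map_const_mul, gaussianReal_map_add_const]
    congr 1
    · simp
    · ext
      simp
  rw [h, map_measureReal_apply (by fun_prop) measurableSet_Iic, stdNormalCdf_eq_gaussianReal_Iic]
  congr 1
  ext x
  simp only [Set.mem_preimage, Set.mem_Iic]
  rw [le_div_iff₀ hw', mul_comm, le_sub_iff_add_le]

/-- `E[Φ(aY + b)] = Φ((a E[Y] + b) / √(1 + a² Var(Y)))` for Gaussian `Y`. -/
lemma integral_stdNormalCdf_gaussianReal (m : ℝ) (v : NNReal) (a b : ℝ) :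
    ∫ x, stdNormalCdf (a * x + b) ∂gaussianReal m v =
      stdNormalCdf ((a * m + b) / √(1 + a ^ 2 * v)) := by
  set w : NNReal := .mk ((-a) ^ 2) (sq_nonneg _) * v with hw
  have hconv := gaussianReal_conv_gaussianReal (m₁ := -a * m) (m₂ := 0) (v₁ := w) (v₂ := 1)
  have hint : Integrable ((Set.Iic b).indicator (fun _ ↦ (1 : ℝ)))
      (gaussianReal (-a * m) w ∗ gaussianReal 0 1) :=
    (integrable_const 1).indicator measurableSet_Iic
  have hinner (x : ℝ) : ∫ y, (Set.Iic b).indicator (fun _ ↦ (1 : ℝ)) (x + y) ∂gaussianReal 0 1 =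
      stdNormalCdf (b - x) := by
    have : (fun y ↦ (Set.Iic b).indicator (fun _ ↦ (1 : ℝ)) (x + y)) =
        (Set.Iic (b - x)).indicator 1 := by
      ext y
      simp [Set.indicator_apply, le_sub_iff_add_le']
    rw [this, integral_indicator_one measurableSet_Iic, stdNormalCdf_eq_gaussianReal_Iic]
  have key := integral_conv hint
  simp_rw [hinner] at key
  have hmeas : Measurable fun x ↦ stdNormalCdf (b - x) :=
    monotone_stdNormalCdf.measurable.comp (by fun_prop)
  rw [hconv, hw, ← gaussianReal_map_const_mul, integral_map (by fun_prop)
    hmeas.aestronglyMeasurable, ← hw] at key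
  have hone := integral_indicator_one (μ := gaussianReal (-a * m + 0) (w + 1))
    (measurableSet_Iic (a := b))
  change ∫ x, (Set.Iic b).indicator (fun _ ↦ (1 : ℝ)) x ∂_ = _ at hone
  rw [hone, gaussianReal_real_Iic _ _ (by positivity)] at key
  convert key.symm using 3
  · ring_nf
  · ring
  · simp [hw, add_comm]

/-- Exponential tilting of a Gaussian measure shifts its mean. -/
lemma integral_exp_mul_gaussianReal (m : ℝ) (v : NNReal) (a b : ℝ) (f : ℝ → ℝ) :
    ∫ x, Real.exp (a * x + b) * f x ∂gaussianReal m v =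
      Real.exp (a * m + b + a ^ 2 * v / 2) * ∫ x, f x ∂gaussianReal (m + a * v) v := by
  by_cases hv : v = 0
  · simp [hv]
  have hv' : (v : ℝ) ≠ 0 := by exact_mod_cast hv
  rw [integral_gaussianReal_eq_integral_smul hv, integral_gaussianReal_eq_integral_smul hv,
    ← integral_const_mul]
  congr 1
  ext x
  have hexp : Real.exp (-(x - m) ^ 2 / (2 * v)) * Real.exp (a * x + b) =
      Real.exp (a * m + b + a ^ 2 * v / 2) * Real.exp (-(x - (m + a * v)) ^ 2 / (2 * v)) := by
    rw [← Real.exp_add, ← Real.exp_add]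
    congr 1
    field_simp
    ring
  simp only [gaussianPDFReal, smul_eq_mul]
  linear_combination (√(2 * Real.pi * v))⁻¹ * f x * hexp

/-- identity (eq094) in the proof of Lemma 5: for `X ∼ N(μ,σ²)` with
`σ ≥ 0` and `α₁, α₂, β₁, β₂ ∈ ℝ`,
`E[e^{α₁X+β₁}Φ(α₂X+β₂)] = e^{α₁μ+β₁+α₁²σ²/2}Φ((α₂μ+β₂+α₁α₂σ²)/√(1+α₂²σ²))`. -/
theorem expectation_exp_mul_normal_cdf
    {Ω : Type*} [MeasurableSpace Ω] (P : Measure Ω) [IsProbabilityMeasure P]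
    (μ σ : ℝ) (hσ : 0 ≤ σ)
    (X : Ω → ℝ) (hXm : Measurable X)
    (hX : Measure.map X P = gaussianReal μ (Real.toNNReal (σ ^ 2)))
    (α1 α2 β1 β2 : ℝ) :
    ∫ ω, Real.exp (α1 * X ω + β1) * stdNormalCdf (α2 * X ω + β2) ∂P =
      Real.exp (α1 * μ + β1 + α1 ^ 2 * σ ^ 2 / 2) *
        stdNormalCdf ((α2 * μ + β2 + α1 * α2 * σ ^ 2) /
          Real.sqrt (1 + α2 ^ 2 * σ ^ 2)) := by
  have hmeas : Measurable fun x ↦ Real.exp (α1 * x + β1) * stdNormalCdf (α2 * x + β2) :=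
    Measurable.mul (by fun_prop) (monotone_stdNormalCdf.measurable.comp (by fun_prop))
  rw [← integral_map (f := fun x ↦ Real.exp (α1 * x + β1) * stdNormalCdf (α2 * x + β2))
    hXm.aemeasurable hmeas.aestronglyMeasurable, hX, integral_exp_mul_gaussianReal,
    integral_stdNormalCdf_gaussianReal, Real.coe_toNNReal _ (sq_nonneg σ)]
  ring_nf
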